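/- arXiv:1910.13542 — 2 statements merged into one kernel-verified Lean document; each statement's English description precedes it below -/
import Mathlib

section
/- Let T>0, let Ω ⊂ ℝ³ be a bounded measurable set, and let η : ℝ×ℝ³ → ℝ³ and q : ℝ×ℝ³ → ℝ be C^∞ functions all of whose partial derivatives are bounded on [0,T]×Ω, with η(0,x) = x for all x. Set v = ∂_tη and let a be the cofactor matrix of ∇η. Then for every t ∈ [0,T]: ∫₀ᵗ∫_Ω q ∂_t²a^{μα} ∂_t²∂_μv_α dx ds = ∫_Ω (q ε^{α2τ} ∂₃∂_tv_τ ∂₁∂_tv_α)(t) dx − ∫_Ω (q ε^{α3τ} ∂₂∂_tv_τ ∂₁∂_tv_α)(t) dx − ∫_Ω (q ε^{α1τ} ∂₃∂_tv_τ ∂₂∂_tv_α)(t) dx − ∫₀ᵗ∫_Ω ∂_t(q ε^{αλτ} ∂₂η_λ) ∂₃∂_tv_τ ∂₁∂_tv_α + ∫₀ᵗ∫_Ω ∂_t(q ε^{αλτ} ∂₃η_λ) ∂₂∂_tv_τ ∂₁∂_tv_α + ∫₀ᵗ∫_Ω ∂_t(q ε^{αλτ} ∂₁η_λ) ∂₃∂_tv_τ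 ∂₂∂_tv_α + ∫_Ω (q ε^{αλτ} (∫₀ᵗ ∂₂v_λ ds) ∂₃∂_tv_τ ∂₁∂_tv_α)(t) dx − ∫_Ω (q ε^{αλτ} (∫₀ᵗ ∂₃v_λ ds) ∂₂∂_tv_τ ∂₁∂_tv_α)(t) dx − ∫_Ω (q ε^{αλτ} (∫₀ᵗ ∂₁v_λ ds) ∂₃∂_tv_τ ∂₂∂_tv_α)(t) dx − ∫_Ω (q ε^{α2τ} ∂₃∂_tv_τ ∂₁∂_tv_α)(0) dx + ∫_Ω (q ε^{α3τ} ∂₂∂_tv_τ ∂₁∂_tv_α)(0) dx + ∫_Ω (q ε^{α1τ} ∂₃∂_tv_τ ∂₂∂_tv_α)(0) dx + 2∫₀ᵗ∫_Ω q ε^{αλτ} ∂₂v_λ ∂₃v_τ ∂_t²∂₁v_α − 2∫₀ᵗ∫_Ω q ε^{αλτ} ∂₁v_λ ∂₃v_τ ∂_t²∂₂v_α + 2∫₀ᵗ∫_Ω q ε^{αλτ} ∂₁v_λ ∂₂v_τ ∂_t²∂₃v_α. (This is Lemma 5.1 of the paper, the cofactor-type cancellation identity, in the case E = ∂_t, i.e.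 D = ∂_t².) -/
open MeasureTheory

noncomputable section

/-- The Levi-Civita symbol `ε` on three indices (indices `0,1,2` stand for `1,2,3`). -/
def eps (i j k : Fin 3) : ℝ :=
  if (i, j, k) = ((0 : Fin 3), (1 : Fin 3), (2 : Fin 3)) ∨ (i, j, k) = (1, 2, 0) ∨
      (i, j, k) = (2, 0, 1) then 1
  else if (i, j, k) = ((0 : Fin 3), (2 : Fin 3), (1 : Fin 3)) ∨ (i, j, k) = (2, 1, 0) ∨
      (i, j, k) = (1, 0, 2) then -1
  else 0

/-- Time derivative `∂_t` of a scalar field on `ℝ × ℝ³`. -/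
def Dt (f : ℝ × (Fin 3 → ℝ) → ℝ) : ℝ × (Fin 3 → ℝ) → ℝ :=
  fun p => deriv (fun s => f (s, p.2)) p.1

/-- Spatial partial derivative `∂_μ` of a scalar field on `ℝ × ℝ³`
(`μ = 0,1,2` standing for `1,2,3`). -/
def Dx (μ : Fin 3) (f : ℝ × (Fin 3 → ℝ) → ℝ) : ℝ × (Fin 3 → ℝ) → ℝ :=
  fun p => fderiv ℝ (fun y => f (p.1, y)) p.2 (Pi.single μ 1)

/-- The cofactor matrix `a` of `∇η`: `a^{1α} = ε^{αλτ}∂₂η_λ∂₃η_τ`,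
`a^{2α} = −ε^{αλτ}∂₁η_λ∂₃η_τ`, `a^{3α} = ε^{αλτ}∂₁η_λ∂₂η_τ`. -/
def cof (η : ℝ × (Fin 3 → ℝ) → Fin 3 → ℝ) (μ α : Fin 3) : ℝ × (Fin 3 → ℝ) → ℝ :=
  fun p =>
    if μ = 0 then
      ∑ lam : Fin 3, ∑ τ : Fin 3,
        eps α lam τ * Dx 1 (fun r => η r lam) p * Dx 2 (fun r => η r τ) p
    else if μ = 1 then
      - ∑ lam : Fin 3, ∑ τ : Fin 3,
        eps α lam τ * Dx 0 (fun r => η r lam) p * Dx 2 (fun r => η r τ) p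
    else
      ∑ lam : Fin 3, ∑ τ : Fin 3,
        eps α lam τ * Dx 0 (fun r => η r lam) p * Dx 1 (fun r => η r τ) p

lemma Dt_eq_fderiv {f : ℝ × (Fin 3 → ℝ) → ℝ} (hf : ContDiff ℝ (⊤ : ℕ∞) f) :
    Dt f = fun p => fderiv ℝ f p (1, 0) := by
  funext p
  have h := (hf.differentiable (by simp) p |>.hasFDerivAt).comp_hasDerivAt p.1
    ((hasDerivAt_id p.1).prodMk (hasDerivAt_const p.1 p.2))
  exact h.deriv

lemma Dx_eq_fderiv (μ : Fin 3) {f : ℝ × (Fin 3 → ℝ) → ℝ} (hf : ContDiff ℝ (⊤ : ℕ∞) f) :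
    Dx μ f = fun p => fderiv ℝ f p (0, Pi.single μ 1) := by
  funext p
  have h := (hf.differentiable (by simp) p |>.hasFDerivAt).comp p.2
    ((hasFDerivAt_const p.1 p.2).prodMk (hasFDerivAt_id (𝕜 := ℝ) p.2))
  change fderiv ℝ (f ∘ fun y => (p.1, id y)) p.2 (Pi.single μ 1) = _
  rw [h.fderiv]
  simp

lemma contDiff_fderiv_apply {f : ℝ × (Fin 3 → ℝ) → ℝ} (hf : ContDiff ℝ (⊤ : ℕ∞) f)
    (u : ℝ × (Fin 3 → ℝ)) : ContDiff ℝ (⊤ : ℕ∞) (fun p => fderiv ℝ f p u) :=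
  (hf.fderiv_right (m := (⊤ : ℕ∞)) (by simp)).clm_apply contDiff_const

lemma contDiff_Dt {f : ℝ × (Fin 3 → ℝ) → ℝ} (hf : ContDiff ℝ (⊤ : ℕ∞) f) :
    ContDiff ℝ (⊤ : ℕ∞) (Dt f) := by
  rw [Dt_eq_fderiv hf]
  exact contDiff_fderiv_apply hf _

lemma contDiff_Dx (μ : Fin 3) {f : ℝ × (Fin 3 → ℝ) → ℝ} (hf : ContDiff ℝ (⊤ : ℕ∞) f) :
    ContDiff ℝ (⊤ : ℕ∞) (Dx μ f) := by
  rw [Dx_eq_fderiv μ hf]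
  exact contDiff_fderiv_apply hf _

lemma fderiv_fderiv_apply {f : ℝ × (Fin 3 → ℝ) → ℝ} (hf : ContDiff ℝ (⊤ : ℕ∞) f)
    (p u w : ℝ × (Fin 3 → ℝ)) :
    fderiv ℝ (fun r => fderiv ℝ f r u) p w = fderiv ℝ (fderiv ℝ f) p w u := by
  have hd : DifferentiableAt ℝ (fderiv ℝ f) p :=
    (hf.fderiv_right (m := (⊤ : ℕ∞)) (by simp)).differentiable (by simp) p
  rw [fderiv_clm_apply hd (differentiableAt_const u)]
  simp

/-- Time and space derivatives of a smooth field commute. -/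
lemma Dx_Dt_comm (μ : Fin 3) {f : ℝ × (Fin 3 → ℝ) → ℝ} (hf : ContDiff ℝ (⊤ : ℕ∞) f) :
    Dx μ (Dt f) = Dt (Dx μ f) := by
  rw [Dx_eq_fderiv μ (contDiff_Dt hf), Dt_eq_fderiv (contDiff_Dx μ hf), Dt_eq_fderiv hf,
    Dx_eq_fderiv μ hf]
  funext p
  rw [fderiv_fderiv_apply hf, fderiv_fderiv_apply hf]
  exact (hf.contDiffAt.isSymmSndFDerivAt
    (by
      rw [minSmoothness_of_isRCLikeNormedField]
      exact WithTop.coe_le_coe.2 (le_top : (2 : ℕ∞) ≤ ⊤))).eq _ _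

lemma hasDerivAt_Dt {f : ℝ × (Fin 3 → ℝ) → ℝ} (hf : ContDiff ℝ (⊤ : ℕ∞) f)
    (s : ℝ) (x : Fin 3 → ℝ) : HasDerivAt (fun r => f (r, x)) (Dt f (s, x)) s := by
  have h : DifferentiableAt ℝ (fun r => f (r, x)) s :=
    (hf.differentiable (by simp)).comp (differentiable_id.prodMk (differentiable_const x)) s
  exact h.hasDerivAt

lemma Dt_eq_of_hasDerivAt {f g : ℝ × (Fin 3 → ℝ) → ℝ}
    (h : ∀ s x, HasDerivAt (fun r => f (r, x)) (g (s, x)) s) : Dt f = g :=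
  funext fun p => (h p.1 p.2).deriv

/-- The second time derivative of `∑ ε^{αλτ} f_λ g_τ`. -/
lemma Dt_Dt_eps_sum (α : Fin 3) {f g : Fin 3 → ℝ × (Fin 3 → ℝ) → ℝ}
    (hf : ∀ l, ContDiff ℝ (⊤ : ℕ∞) (f l)) (hg : ∀ l, ContDiff ℝ (⊤ : ℕ∞) (g l)) :
    Dt (Dt (fun p => ∑ l : Fin 3, ∑ m : Fin 3, eps α l m * f l p * g m p)) =
      fun p => ∑ l : Fin 3, ∑ m : Fin 3, eps α l m *
        (Dt (Dt (f l)) p * g m p + 2 * (Dt (f l) p * Dt (g m) p) + f l p * Dt (Dt (g m)) p) := by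
  have h1 : Dt (fun p => ∑ l : Fin 3, ∑ m : Fin 3, eps α l m * f l p * g m p) =
      fun p => ∑ l : Fin 3, ∑ m : Fin 3,
        (eps α l m * Dt (f l) p * g m p + eps α l m * f l p * Dt (g m) p) :=
    Dt_eq_of_hasDerivAt fun s x => HasDerivAt.fun_sum fun l _ => HasDerivAt.fun_sum fun m _ =>
      ((hasDerivAt_Dt (hf l) s x).const_mul _).mul (hasDerivAt_Dt (hg m) s x)
  rw [h1]
  refine Dt_eq_of_hasDerivAt fun s x => HasDerivAt.fun_sum fun l _ => HasDerivAt.fun_sum fun m _ =>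
    HasDerivAt.congr_deriv
      ((((hasDerivAt_Dt (contDiff_Dt (hf l)) s x).const_mul _).mul (hasDerivAt_Dt (hg m) s x)).add
      (((hasDerivAt_Dt (hf l) s x).const_mul _).mul (hasDerivAt_Dt (contDiff_Dt (hg m)) s x))) ?_
  ring

section Integration

variable {Ω : Set (Fin 3 → ℝ)}

lemma integrable_restrict_of_continuous (hΩ : Bornology.IsBounded Ω) {G : (Fin 3 → ℝ) → ℝ}
    (hG : Continuous G) :
    Integrable G (volume.restrict Ω) :=
  (hG.continuousOn.integrableOn_compact hΩ.isCompact_closure).mono_set subset_closure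

lemma integrable_uIoc_prod (hΩ : Bornology.IsBounded Ω) {G : ℝ × (Fin 3 → ℝ) → ℝ}
    (hG : Continuous G) (a b : ℝ) :
    Integrable G ((volume.restrict (Set.uIoc a b)).prod (volume.restrict Ω)) := by
  rw [Measure.prod_restrict]
  exact (hG.continuousOn.integrableOn_compact
    (isCompact_uIcc.prod hΩ.isCompact_closure)).mono_set
      (Set.prod_mono Set.uIoc_subset_uIcc subset_closure)

lemma intervalIntegrable_setIntegral (hΩ : Bornology.IsBounded Ω) {G : ℝ × (Fin 3 → ℝ) → ℝ}
    (hG : Continuous G) (a b : ℝ) :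
    IntervalIntegrable (fun s => ∫ x in Ω, G (s, x)) volume a b := by
  rw [intervalIntegrable_iff]
  exact (integrable_uIoc_prod hΩ hG a b).integral_prod_left

lemma spacetime_integral_add (hΩ : Bornology.IsBounded Ω) {F G : ℝ → (Fin 3 → ℝ) → ℝ}
    (hF : Continuous fun p : ℝ × (Fin 3 → ℝ) => F p.1 p.2)
    (hG : Continuous fun p : ℝ × (Fin 3 → ℝ) => G p.1 p.2) (a b : ℝ) :
    (∫ s in a..b, ∫ x in Ω, (F s x + G s x)) =
      (∫ s in a..b, ∫ x in Ω, F s x) + ∫ s in a..b, ∫ x in Ω, G s x := by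
  rw [← intervalIntegral.integral_add (intervalIntegrable_setIntegral hΩ hF a b)
    (intervalIntegrable_setIntegral hΩ hG a b)]
  congr 1 with s
  exact integral_add (integrable_restrict_of_continuous hΩ (hF.comp (Continuous.prodMk_right s)))
    (integrable_restrict_of_continuous hΩ (hG.comp (Continuous.prodMk_right s)))

lemma spacetime_integral_const_mul (c : ℝ) (F : ℝ → (Fin 3 → ℝ) → ℝ) (a b : ℝ) :
    (∫ s in a..b, ∫ x in Ω, c * F s x) = c * ∫ s in a..b, ∫ x in Ω, F s x := by
  simp_rw [integral_const_mul, intervalIntegral.integral_const_mul]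

lemma spacetime_integral_sub (hΩ : Bornology.IsBounded Ω) {F G : ℝ → (Fin 3 → ℝ) → ℝ}
    (hF : Continuous fun p : ℝ × (Fin 3 → ℝ) => F p.1 p.2)
    (hG : Continuous fun p : ℝ × (Fin 3 → ℝ) => G p.1 p.2) (a b : ℝ) :
    (∫ s in a..b, ∫ x in Ω, (F s x - G s x)) =
      (∫ s in a..b, ∫ x in Ω, F s x) - ∫ s in a..b, ∫ x in Ω, G s x := by
  have h := spacetime_integral_add hΩ hF (G := fun s x => -1 * G s x) (hG.const_mul (-1)) a b
  rw [spacetime_integral_const_mul] at h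
  simpa [sub_eq_add_neg] using h

/-- The fundamental theorem of calculus in time, integrated over `Ω`. -/
lemma spacetime_integral_Dt (hΩ : Bornology.IsBounded Ω) {G : ℝ × (Fin 3 → ℝ) → ℝ}
    (hG : ContDiff ℝ (⊤ : ℕ∞) G) (a b : ℝ) :
    (∫ s in a..b, ∫ x in Ω, Dt G (s, x)) = (∫ x in Ω, G (b, x)) - ∫ x in Ω, G (a, x) := by
  have hc : Continuous (Dt G) := (contDiff_Dt hG).continuous
  have hGc := hG.continuous
  rw [intervalIntegral_integral_swap (f := fun s x => Dt G (s, x))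
      (integrable_uIoc_prod hΩ hc a b),
    ← integral_sub (integrable_restrict_of_continuous hΩ (by fun_prop))
      (integrable_restrict_of_continuous hΩ (by fun_prop))]
  congr 1 with x
  exact intervalIntegral.integral_eq_sub_of_hasDerivAt (fun s _ => hasDerivAt_Dt hG s x)
    ((by fun_prop : Continuous fun s => Dt G (s, x)).intervalIntegrable a b)

/-- Integration by parts in time for `∑ q ε^{αλτ} N_λ A_τ B_α`, where `N_λ` is initially the
`i`-th unit vector. -/
lemma integral_by_parts_eps (hΩ : Bornology.IsBounded Ω) (i : Fin 3)
    {q : ℝ × (Fin 3 → ℝ) → ℝ} {N A B : Fin 3 → ℝ × (Fin 3 → ℝ) → ℝ}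
    (hq : ContDiff ℝ (⊤ : ℕ∞) q) (hN : ∀ l, ContDiff ℝ (⊤ : ℕ∞) (N l))
    (hA : ∀ l, ContDiff ℝ (⊤ : ℕ∞) (A l)) (hB : ∀ l, ContDiff ℝ (⊤ : ℕ∞) (B l))
    (hN0 : ∀ l x, N l (0, x) = if l = i then 1 else 0) (t : ℝ) :
    (∫ s in (0:ℝ)..t, ∫ x in Ω, ∑ α : Fin 3, ∑ l : Fin 3, ∑ m : Fin 3,
        q (s, x) * eps α l m * N l (s, x) *
          (Dt (A m) (s, x) * B α (s, x) + A m (s, x) * Dt (B α) (s, x))) =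
      (∫ x in Ω, ∑ α : Fin 3, ∑ m : Fin 3, q (t, x) * eps α i m * A m (t, x) * B α (t, x))
      - (∫ x in Ω, ∑ α : Fin 3, ∑ m : Fin 3, q (0, x) * eps α i m * A m (0, x) * B α (0, x))
      + (∫ x in Ω, ∑ α : Fin 3, ∑ l : Fin 3, ∑ m : Fin 3,
          q (t, x) * eps α l m * (∫ s in (0:ℝ)..t, Dt (N l) (s, x)) * A m (t, x) * B α (t, x))
      - ∫ s in (0:ℝ)..t, ∫ x in Ω, ∑ α : Fin 3, ∑ l : Fin 3, ∑ m : Fin 3,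
          Dt (fun r => q r * eps α l m * N l r) (s, x) * A m (s, x) * B α (s, x) := by
  have hqN (α l m : Fin 3) : ContDiff ℝ (⊤ : ℕ∞) (fun r => q r * eps α l m * N l r) :=
    (hq.mul contDiff_const).mul (hN l)
  have hqNt (α l m : Fin 3) : Continuous (Dt fun r => q r * eps α l m * N l r) :=
    (contDiff_Dt (hqN α l m)).continuous
  have hAt (m : Fin 3) : Continuous (Dt (A m)) := (contDiff_Dt (hA m)).continuous
  have hBt (m : Fin 3) : Continuous (Dt (B m)) := (contDiff_Dt (hB m)).continuous
  have hqc := hq.continuous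
  have hNc (m : Fin 3) := (hN m).continuous
  have hAc (m : Fin 3) := (hA m).continuous
  have hBc (m : Fin 3) := (hB m).continuous
  have hG : ContDiff ℝ (⊤ : ℕ∞) (fun r => ∑ α : Fin 3, ∑ l : Fin 3, ∑ m : Fin 3,
      q r * eps α l m * N l r * A m r * B α r) := by fun_prop
  have hDt : Dt (fun r => ∑ α : Fin 3, ∑ l : Fin 3, ∑ m : Fin 3,
      q r * eps α l m * N l r * A m r * B α r) =
      fun r => (∑ α : Fin 3, ∑ l : Fin 3, ∑ m : Fin 3,
          Dt (fun r => q r * eps α l m * N l r) r * A m r * B α r) +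
        ∑ α : Fin 3, ∑ l : Fin 3, ∑ m : Fin 3, q r * eps α l m * N l r *
          (Dt (A m) r * B α r + A m r * Dt (B α) r) := by
    refine Dt_eq_of_hasDerivAt fun s x => ?_
    simp_rw [← Finset.sum_add_distrib]
    refine HasDerivAt.fun_sum fun α _ => HasDerivAt.fun_sum fun l _ =>
      HasDerivAt.fun_sum fun m _ => HasDerivAt.congr_deriv
        (((hasDerivAt_Dt (hqN α l m) s x).fun_mul (hasDerivAt_Dt (hA m) s x)).fun_mul
          (hasDerivAt_Dt (hB α) s x)) ?_
    ring
  have hFTC := spacetime_integral_Dt hΩ hG 0 t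
  rw [hDt] at hFTC
  beta_reduce at hFTC
  rw [spacetime_integral_add hΩ (by fun_prop) (by fun_prop)] at hFTC
  have hNt (l : Fin 3) (x : Fin 3 → ℝ) :
      N l (t, x) = (if l = i then 1 else 0) + ∫ s in (0:ℝ)..t, Dt (N l) (s, x) := by
    have hc : Continuous (Dt (N l)) := (contDiff_Dt (hN l)).continuous
    rw [intervalIntegral.integral_eq_sub_of_hasDerivAt (fun s _ => hasDerivAt_Dt (hN l) s x)
      ((by fun_prop : Continuous fun s => Dt (N l) (s, x)).intervalIntegrable 0 t), hN0]
    ring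
  have hI (l : Fin 3) : Continuous fun x => ∫ s in (0:ℝ)..t, Dt (N l) (s, x) := by
    have h : (fun x => ∫ s in (0:ℝ)..t, Dt (N l) (s, x)) =
        fun x => N l (t, x) - if l = i then 1 else 0 := by
      funext x
      rw [hNt l x]
      ring
    rw [h]
    fun_prop
  have h0 : (∫ x in Ω, ∑ α : Fin 3, ∑ l : Fin 3, ∑ m : Fin 3,
      q (0, x) * eps α l m * N l (0, x) * A m (0, x) * B α (0, x)) =
      ∫ x in Ω, ∑ α : Fin 3, ∑ m : Fin 3, q (0, x) * eps α i m * A m (0, x) * B α (0, x) := by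
    congr 1 with x
    refine Finset.sum_congr rfl fun α _ => ?_
    rw [Finset.sum_eq_single i (fun l _ hl => by simp [hN0, hl]) (by simp)]
    simp [hN0]
  have ht : (∫ x in Ω, ∑ α : Fin 3, ∑ l : Fin 3, ∑ m : Fin 3,
      q (t, x) * eps α l m * N l (t, x) * A m (t, x) * B α (t, x)) =
      (∫ x in Ω, ∑ α : Fin 3, ∑ m : Fin 3, q (t, x) * eps α i m * A m (t, x) * B α (t, x)) +
      ∫ x in Ω, ∑ α : Fin 3, ∑ l : Fin 3, ∑ m : Fin 3,
        q (t, x) * eps α l m * (∫ s in (0:ℝ)..t, Dt (N l) (s, x)) * A m (t, x) * B α (t, x) := by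
    rw [← integral_add (integrable_restrict_of_continuous hΩ (by fun_prop))
      (integrable_restrict_of_continuous hΩ (by fun_prop))]
    congr 1 with x
    rw [← Finset.sum_add_distrib]
    refine Finset.sum_congr rfl fun α _ => ?_
    simp_rw [hNt, mul_add, add_mul, Finset.sum_add_distrib]
    congr 1
    rw [Finset.sum_eq_single i (fun l _ hl => by simp [hl]) (by simp)]
    simp
  rw [h0, ht] at hFTC
  linarith

end Integration

/-- **Cofactor-type cancellation** (Lemma 5.1 of the paper with `E = ∂_t`, `D = ∂_t²`):
the highest-order term `∫₀ᵗ∫_Ω q ∂_t²a^{μα} ∂_t²∂_μv_α` can be rewritten, by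
cross-integration by parts, in terms of pointwise-in-time integrals and lower-order
time-space integrals. -/
theorem cofactor_cancellation
    (T : ℝ) (hT : 0 < T)
    (Ω : Set (Fin 3 → ℝ)) (hΩmeas : MeasurableSet Ω) (hΩbdd : Bornology.IsBounded Ω)
    (η : ℝ × (Fin 3 → ℝ) → Fin 3 → ℝ) (q : ℝ × (Fin 3 → ℝ) → ℝ)
    (hη : ContDiff ℝ (⊤ : ℕ∞) η) (hq : ContDiff ℝ (⊤ : ℕ∞) q)
    (hηbdd : ∀ n : ℕ, ∃ M : ℝ, ∀ p ∈ Set.Icc (0 : ℝ) T ×ˢ Ω, ‖iteratedFDeriv ℝ n η p‖ ≤ M)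
    (hqbdd : ∀ n : ℕ, ∃ M : ℝ, ∀ p ∈ Set.Icc (0 : ℝ) T ×ˢ Ω, ‖iteratedFDeriv ℝ n q p‖ ≤ M)
    (hη0 : ∀ x : Fin 3 → ℝ, η (0, x) = x)
    (v : ℝ × (Fin 3 → ℝ) → Fin 3 → ℝ)
    (hv : ∀ (p : ℝ × (Fin 3 → ℝ)) (α : Fin 3), v p α = Dt (fun r => η r α) p)
    (a : Fin 3 → Fin 3 → ℝ × (Fin 3 → ℝ) → ℝ) (ha : ∀ μ α, a μ α = cof η μ α) :
    ∀ t ∈ Set.Icc (0 : ℝ) T,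
      (∫ s in (0:ℝ)..t, ∫ x in Ω, ∑ μ : Fin 3, ∑ α : Fin 3,
          q (s, x) * Dt (Dt (a μ α)) (s, x) * Dt (Dt (Dx μ (fun r => v r α))) (s, x))
      = (∫ x in Ω, ∑ α : Fin 3, ∑ τ : Fin 3,
            q (t, x) * eps α 1 τ * Dx 2 (Dt (fun r => v r τ)) (t, x)
              * Dx 0 (Dt (fun r => v r α)) (t, x))
        - (∫ x in Ω, ∑ α : Fin 3, ∑ τ : Fin 3,
            q (t, x) * eps α 2 τ * Dx 1 (Dt (fun r => v r τ)) (t, x)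
              * Dx 0 (Dt (fun r => v r α)) (t, x))
        - (∫ x in Ω, ∑ α : Fin 3, ∑ τ : Fin 3,
            q (t, x) * eps α 0 τ * Dx 2 (Dt (fun r => v r τ)) (t, x)
              * Dx 1 (Dt (fun r => v r α)) (t, x))
        - (∫ s in (0:ℝ)..t, ∫ x in Ω, ∑ α : Fin 3, ∑ lam : Fin 3, ∑ τ : Fin 3,
            Dt (fun r => q r * eps α lam τ * Dx 1 (fun r' => η r' lam) r) (s, x)
              * Dx 2 (Dt (fun r => v r τ)) (s, x) * Dx 0 (Dt (fun r => v r α)) (s, x))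
        + (∫ s in (0:ℝ)..t, ∫ x in Ω, ∑ α : Fin 3, ∑ lam : Fin 3, ∑ τ : Fin 3,
            Dt (fun r => q r * eps α lam τ * Dx 2 (fun r' => η r' lam) r) (s, x)
              * Dx 1 (Dt (fun r => v r τ)) (s, x) * Dx 0 (Dt (fun r => v r α)) (s, x))
        + (∫ s in (0:ℝ)..t, ∫ x in Ω, ∑ α : Fin 3, ∑ lam : Fin 3, ∑ τ : Fin 3,
            Dt (fun r => q r * eps α lam τ * Dx 0 (fun r' => η r' lam) r) (s, x)
              * Dx 2 (Dt (fun r => v r τ)) (s, x) * Dx 1 (Dt (fun r => v r α)) (s, x))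
        + (∫ x in Ω, ∑ α : Fin 3, ∑ lam : Fin 3, ∑ τ : Fin 3,
            q (t, x) * eps α lam τ * (∫ s in (0:ℝ)..t, Dx 1 (fun r => v r lam) (s, x))
              * Dx 2 (Dt (fun r => v r τ)) (t, x) * Dx 0 (Dt (fun r => v r α)) (t, x))
        - (∫ x in Ω, ∑ α : Fin 3, ∑ lam : Fin 3, ∑ τ : Fin 3,
            q (t, x) * eps α lam τ * (∫ s in (0:ℝ)..t, Dx 2 (fun r => v r lam) (s, x))
              * Dx 1 (Dt (fun r => v r τ)) (t, x) * Dx 0 (Dt (fun r => v r α)) (t, x))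
        - (∫ x in Ω, ∑ α : Fin 3, ∑ lam : Fin 3, ∑ τ : Fin 3,
            q (t, x) * eps α lam τ * (∫ s in (0:ℝ)..t, Dx 0 (fun r => v r lam) (s, x))
              * Dx 2 (Dt (fun r => v r τ)) (t, x) * Dx 1 (Dt (fun r => v r α)) (t, x))
        - (∫ x in Ω, ∑ α : Fin 3, ∑ τ : Fin 3,
            q (0, x) * eps α 1 τ * Dx 2 (Dt (fun r => v r τ)) (0, x)
              * Dx 0 (Dt (fun r => v r α)) (0, x))
        + (∫ x in Ω, ∑ α : Fin 3, ∑ τ : Fin 3,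
            q (0, x) * eps α 2 τ * Dx 1 (Dt (fun r => v r τ)) (0, x)
              * Dx 0 (Dt (fun r => v r α)) (0, x))
        + (∫ x in Ω, ∑ α : Fin 3, ∑ τ : Fin 3,
            q (0, x) * eps α 0 τ * Dx 2 (Dt (fun r => v r τ)) (0, x)
              * Dx 1 (Dt (fun r => v r α)) (0, x))
        + 2 * (∫ s in (0:ℝ)..t, ∫ x in Ω, ∑ α : Fin 3, ∑ lam : Fin 3, ∑ τ : Fin 3,
            q (s, x) * eps α lam τ * Dx 1 (fun r => v r lam) (s, x)
              * Dx 2 (fun r => v r τ) (s, x) * Dt (Dt (Dx 0 (fun r => v r α))) (s, x))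
        - 2 * (∫ s in (0:ℝ)..t, ∫ x in Ω, ∑ α : Fin 3, ∑ lam : Fin 3, ∑ τ : Fin 3,
            q (s, x) * eps α lam τ * Dx 0 (fun r => v r lam) (s, x)
              * Dx 2 (fun r => v r τ) (s, x) * Dt (Dt (Dx 1 (fun r => v r α))) (s, x))
        + 2 * (∫ s in (0:ℝ)..t, ∫ x in Ω, ∑ α : Fin 3, ∑ lam : Fin 3, ∑ τ : Fin 3,
            q (s, x) * eps α lam τ * Dx 0 (fun r => v r lam) (s, x)
              * Dx 1 (fun r => v r τ) (s, x) * Dt (Dt (Dx 2 (fun r => v r α))) (s, x)) := by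
  intro t _
  have hηc (α : Fin 3) : ContDiff ℝ (⊤ : ℕ∞) (fun r => η r α) := contDiff_pi.1 hη α
  have hvη (α : Fin 3) : (fun r => v r α) = Dt (fun r => η r α) := funext fun p => hv p α
  have hv1 (μ α : Fin 3) := Dx_Dt_comm μ (hηc α)
  have hv2 (μ α : Fin 3) : Dx μ (Dt (Dt fun r => η r α)) = Dt (Dt (Dx μ fun r => η r α)) := by
    rw [Dx_Dt_comm μ (contDiff_Dt (hηc α)), hv1]
  have hN0 (μ α : Fin 3) (x : Fin 3 → ℝ) :
      Dx μ (fun r => η r α) (0, x) = if α = μ then 1 else 0 := by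
    have h : fderiv ℝ (fun y : Fin 3 → ℝ => y α) x = ContinuousLinearMap.proj α :=
      (hasFDerivAt_apply α x).fderiv
    simp [Dx, hη0, h, Pi.single_apply]
  have hN (μ α : Fin 3) := contDiff_Dx μ (hηc α)
  simp_rw [hvη, hv2, hv1, ha]
  have ha0 (α : Fin 3) : cof η 0 α = fun p => ∑ l : Fin 3, ∑ m : Fin 3,
      eps α l m * Dx 1 (fun r => η r l) p * Dx 2 (fun r => η r m) p := rfl
  have ha1 (α : Fin 3) : cof η 1 α = fun p => ∑ l : Fin 3, ∑ m : Fin 3,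
      eps α l m * (-Dx 0 (fun r => η r l) p) * Dx 2 (fun r => η r m) p := by
    funext p
    simp [cof]
  have ha2 (α : Fin 3) : cof η 2 α = fun p => ∑ l : Fin 3, ∑ m : Fin 3,
      eps α l m * Dx 0 (fun r => η r l) p * Dx 1 (fun r => η r m) p := rfl
  obtain ⟨N, hNe⟩ : ∃ N : Fin 3 → Fin 3 → ℝ × (Fin 3 → ℝ) → ℝ,
      ∀ μ α, (Dx μ fun r => η r α) = N μ α := ⟨_, fun _ _ => rfl⟩
  simp_rw [hNe] at hN0 hN ha0 ha1 ha2 ⊢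
  have hD1 (μ α : Fin 3) := contDiff_Dt (hN μ α)
  have hD2 (μ α : Fin 3) := contDiff_Dt (hD1 μ α)
  have hc0 (μ α : Fin 3) := (hN μ α).continuous
  have hc1 (μ α : Fin 3) := (hD1 μ α).continuous
  have hc2 (μ α : Fin 3) := (hD2 μ α).continuous
  have hc3 (μ α : Fin 3) := (contDiff_Dt (hD2 μ α)).continuous
  have hqc := hq.continuous
  have hneg (f : ℝ × (Fin 3 → ℝ) → ℝ) : Dt (fun p => -f p) = fun p => -Dt f p := by
    funext p
    simp [Dt]
  have e1 := integral_by_parts_eps hΩbdd 1 hq (hN 1) (hD2 2) (hD2 0) (hN0 1) t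
  have e2 := integral_by_parts_eps hΩbdd 2 hq (hN 2) (hD2 1) (hD2 0) (hN0 2) t
  have e0 := integral_by_parts_eps hΩbdd 0 hq (hN 0) (hD2 2) (hD2 1) (hN0 0) t
  have key (p : ℝ × (Fin 3 → ℝ)) : (∑ μ : Fin 3, ∑ α : Fin 3,
      q p * Dt (Dt (cof η μ α)) p * Dt (Dt (Dt (N μ α))) p) =
      (∑ α : Fin 3, ∑ l : Fin 3, ∑ m : Fin 3, q p * eps α l m * N 1 l p *
        (Dt (Dt (Dt (N 2 m))) p * Dt (Dt (N 0 α)) p + Dt (Dt (N 2 m)) p * Dt (Dt (Dt (N 0 α))) p))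
      - (∑ α : Fin 3, ∑ l : Fin 3, ∑ m : Fin 3, q p * eps α l m * N 2 l p *
        (Dt (Dt (Dt (N 1 m))) p * Dt (Dt (N 0 α)) p + Dt (Dt (N 1 m)) p * Dt (Dt (Dt (N 0 α))) p))
      - (∑ α : Fin 3, ∑ l : Fin 3, ∑ m : Fin 3, q p * eps α l m * N 0 l p *
        (Dt (Dt (Dt (N 2 m))) p * Dt (Dt (N 1 α)) p + Dt (Dt (N 2 m)) p * Dt (Dt (Dt (N 1 α))) p))
      + 2 * (∑ α : Fin 3, ∑ l : Fin 3, ∑ m : Fin 3,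
        q p * eps α l m * Dt (N 1 l) p * Dt (N 2 m) p * Dt (Dt (Dt (N 0 α))) p)
      - 2 * (∑ α : Fin 3, ∑ l : Fin 3, ∑ m : Fin 3,
        q p * eps α l m * Dt (N 0 l) p * Dt (N 2 m) p * Dt (Dt (Dt (N 1 α))) p)
      + 2 * (∑ α : Fin 3, ∑ l : Fin 3, ∑ m : Fin 3,
        q p * eps α l m * Dt (N 0 l) p * Dt (N 1 m) p * Dt (Dt (Dt (N 2 α))) p) := by
    have h0 (α : Fin 3) : Dt (Dt (cof η 0 α)) = _ :=
      (congrArg (fun f => Dt (Dt f)) (ha0 α)).trans (Dt_Dt_eps_sum α (hN 1) (hN 2))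
    have h1 (α : Fin 3) : Dt (Dt (cof η 1 α)) = _ :=
      (congrArg (fun f => Dt (Dt f)) (ha1 α)).trans
        (Dt_Dt_eps_sum α (fun l => (hN 0 l).neg) (hN 2))
    have h2 (α : Fin 3) : Dt (Dt (cof η 2 α)) = _ :=
      (congrArg (fun f => Dt (Dt f)) (ha2 α)).trans (Dt_Dt_eps_sum α (hN 0) (hN 1))
    simp only [Fin.sum_univ_three, h0, h1, h2, hneg]
    simp [eps]
    ring
  simp_rw [key]
  rw [spacetime_integral_add hΩbdd, spacetime_integral_sub hΩbdd, spacetime_integral_add hΩbdd,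
    spacetime_integral_sub hΩbdd, spacetime_integral_sub hΩbdd, spacetime_integral_const_mul,
    spacetime_integral_const_mul, spacetime_integral_const_mul, e1, e2, e0]
  · ring
  all_goals fun_prop
end
end

section
/- Let T > 0, C ≥ 1, P₀ ≥ 0 and α, β ≥ 0 be real numbers, and let Q : [0,∞) → [0,∞) be continuous and nondecreasing. Suppose e, f, g, h : [0,T] → [0,∞) are continuous functions satisfying, for all t ∈ [0,T]: e(t) ≤ C( P₀ + e(t)∫₀ᵗ Q(e(s)+f(s)+g(s)+h(s)) ds ); f(t) ≤ C( P₀ + ∫₀ᵗ Q(e+f+g+h) ) e(t)^α; h(t) ≤ C( P₀ + ∫₀ᵗ Q(e+f+g+h) ) e(t)^α; and g(t) ≤ C( P₀ + ∫₀ᵗ Q(e+f+g+h) ) e(t)^β. Then there exist T* > 0 and C* > 0, depending only on C, P₀, Q, α and β (and not on T nor on the functions e, f, g, h), such that e(t), f(t), g(t), h(t) ≤ C* for all t ∈ [0, min(T, T*)]. (This is the barrier argument applied to the closed system of inequalities for E, F, G, H in the concluding estimates, with α = (7+2ν)/6 and β = (3−ν)/3.) -/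
open MeasureTheory

/-- If a continuous nonnegative `w` is bounded by `K` wherever its primitive is at most `δ`, then
its primitive stays below `δ` on any interval `[0, τ]` with `τ * K < δ`. -/
theorem intervalIntegral_le_of_bootstrap {w : ℝ → ℝ} {T τ K δ : ℝ} (hδ : 0 ≤ δ) (hK : 0 ≤ K)
    (hτ : τ * K < δ) (hw : ContinuousOn w (Set.Icc 0 T))
    (hw_nonneg : ∀ t ∈ Set.Icc (0 : ℝ) T, 0 ≤ w t)
    (hboot : ∀ t ∈ Set.Icc (0 : ℝ) T, (∫ s in (0 : ℝ)..t, w s) ≤ δ → w t ≤ K) :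
    ∀ t ∈ Set.Icc (0 : ℝ) (min T τ), (∫ s in (0 : ℝ)..t, w s) ≤ δ := by
  rintro t ⟨ht0, ht⟩
  have htT : t ≤ T := ht.trans (min_le_left _ _)
  have htτ : t ≤ τ := ht.trans (min_le_right _ _)
  by_contra! hlt
  have hint : ∀ a ∈ Set.Icc (0 : ℝ) T, IntervalIntegrable w volume 0 a := fun a ha =>
    (hw.mono (Set.Icc_subset_Icc_right ha.2)).intervalIntegrable_of_Icc ha.1
  have hcont : ContinuousOn (fun a => ∫ s in (0 : ℝ)..a, w s) (Set.Icc 0 t) := by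
    rw [← Set.uIcc_of_le ht0]
    refine intervalIntegral.continuousOn_primitive_interval ?_
    rw [Set.uIcc_of_le ht0]
    exact (hw.mono (Set.Icc_subset_Icc_right htT)).integrableOn_Icc
  obtain ⟨r, ⟨hr0, hrt⟩, hr⟩ :=
    intermediate_value_Icc ht0 hcont ⟨by simpa using hδ, hlt.le⟩
  have hrT : r ≤ T := hrt.trans htT
  have hbound : (∫ s in (0 : ℝ)..r, w s) ≤ ∫ _ in (0 : ℝ)..r, K := by
    refine intervalIntegral.integral_mono_on hr0 (hint r ⟨hr0, hrT⟩) (by simp) fun s hs => ?_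
    refine hboot s ⟨hs.1, hs.2.trans hrT⟩ (le_trans ?_ hr.le)
    refine intervalIntegral.integral_mono_interval le_rfl hs.1 hs.2 ?_ (hint r ⟨hr0, hrT⟩)
    filter_upwards [ae_restrict_mem measurableSet_Ioc] with x hx
    exact hw_nonneg x ⟨hx.1.le, hx.2.trans hrT⟩
  simp only [intervalIntegral.integral_const, sub_zero, smul_eq_mul] at hbound
  have : r * K ≤ τ * K := mul_le_mul_of_nonneg_right (hrt.trans htτ) hK
  simp only at hr
  linarith

/-- **Barrier argument.**  If continuous nonnegative functions `e, f, g, h` on `[0,T]`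
satisfy the closed system of inequalities
`e ≤ C(P₀ + e ∫₀ᵗ Q(e+f+g+h))`, `f, h ≤ C(P₀ + ∫₀ᵗ Q(e+f+g+h)) e^α`,
`g ≤ C(P₀ + ∫₀ᵗ Q(e+f+g+h)) e^β`, then they are bounded by a constant `C*` on a time
interval `[0, min(T,T*)]`, where `T*, C*` depend only on `C, P₀, Q, α, β`. -/
theorem barrier_argument
    (C P₀ α β : ℝ) (hC : 1 ≤ C) (hP₀ : 0 ≤ P₀) (hα : 0 ≤ α) (hβ : 0 ≤ β)
    (Q : ℝ → ℝ) (hQcont : ContinuousOn Q (Set.Ici 0))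
    (hQmono : MonotoneOn Q (Set.Ici 0)) (hQnonneg : ∀ x ∈ Set.Ici (0 : ℝ), 0 ≤ Q x) :
    ∃ Tstar : ℝ, 0 < Tstar ∧ ∃ Cstar : ℝ, 0 < Cstar ∧
      ∀ T : ℝ, 0 < T →
      ∀ e f g h : ℝ → ℝ,
        ContinuousOn e (Set.Icc 0 T) → ContinuousOn f (Set.Icc 0 T) →
        ContinuousOn g (Set.Icc 0 T) → ContinuousOn h (Set.Icc 0 T) →
        (∀ t ∈ Set.Icc (0 : ℝ) T, 0 ≤ e t) → (∀ t ∈ Set.Icc (0 : ℝ) T, 0 ≤ f t) →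
        (∀ t ∈ Set.Icc (0 : ℝ) T, 0 ≤ g t) → (∀ t ∈ Set.Icc (0 : ℝ) T, 0 ≤ h t) →
        (∀ t ∈ Set.Icc (0 : ℝ) T,
          e t ≤ C * (P₀ + e t * ∫ s in (0:ℝ)..t, Q (e s + f s + g s + h s))) →
        (∀ t ∈ Set.Icc (0 : ℝ) T,
          f t ≤ C * (P₀ + ∫ s in (0:ℝ)..t, Q (e s + f s + g s + h s)) * e t ^ α) →
        (∀ t ∈ Set.Icc (0 : ℝ) T,
          h t ≤ C * (P₀ + ∫ s in (0:ℝ)..t, Q (e s + f s + g s + h s)) * e t ^ α) →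
        (∀ t ∈ Set.Icc (0 : ℝ) T,
          g t ≤ C * (P₀ + ∫ s in (0:ℝ)..t, Q (e s + f s + g s + h s)) * e t ^ β) →
        ∀ t ∈ Set.Icc (0 : ℝ) (min T Tstar),
          e t ≤ Cstar ∧ f t ≤ Cstar ∧ g t ≤ Cstar ∧ h t ≤ Cstar := by
  set E : ℝ := 2 * C * P₀ with hE
  have hC0 : 0 < C := by linarith
  have hE0 : 0 ≤ E := by positivity
  set A : ℝ := C * (P₀ + 1) * E ^ α with hA
  set B : ℝ := C * (P₀ + 1) * E ^ β with hB
  have hA0 : 0 ≤ A := by positivity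
  have hB0 : 0 ≤ B := by positivity
  set M : ℝ := E + A + B + A with hM
  have hM0 : 0 ≤ M := by positivity
  set K : ℝ := Q M with hKdef
  have hK : 0 ≤ K := hQnonneg M hM0
  set δ : ℝ := 1 / (2 * C) with hδdef
  have hδ : 0 < δ := by positivity
  have hCδ : C * δ = 1 / 2 := by rw [hδdef]; field_simp
  have hδ1 : δ ≤ 1 := by nlinarith
  have hτ : δ / (K + 1) * K < δ := by
    rw [div_mul_eq_mul_div, div_lt_iff₀ (by positivity)]
    linarith
  refine ⟨δ / (K + 1), by positivity, M + 1, by positivity, ?_⟩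
  intro T hT e f g h ce cf cg ch he hf hg hh ine inf inh ing
  have hS : ∀ t ∈ Set.Icc (0 : ℝ) T, e t + f t + g t + h t ∈ Set.Ici (0 : ℝ) := fun t ht =>
    add_nonneg (add_nonneg (add_nonneg (he t ht) (hf t ht)) (hg t ht)) (hh t ht)
  have key : ∀ t ∈ Set.Icc (0 : ℝ) T, (∫ s in (0 : ℝ)..t, Q (e s + f s + g s + h s)) ≤ δ →
      e t ≤ E ∧ f t ≤ A ∧ g t ≤ B ∧ h t ≤ A := by
    intro t ht hI
    have h0 := he t ht
    have heE : e t ≤ E := by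
      have h1 := ine t ht
      have h2 : C * e t * (∫ s in (0 : ℝ)..t, Q (e s + f s + g s + h s)) ≤ C * e t * δ :=
        mul_le_mul_of_nonneg_left hI (by positivity)
      have h3 : C * e t * δ = e t / 2 := by
        rw [mul_right_comm, hCδ]; ring
      linarith
    have hpow : ∀ γ : ℝ, 0 ≤ γ →
        C * (P₀ + ∫ s in (0 : ℝ)..t, Q (e s + f s + g s + h s)) * e t ^ γ
          ≤ C * (P₀ + 1) * E ^ γ := by
      intro γ hγ
      have h1 : e t ^ γ ≤ E ^ γ := Real.rpow_le_rpow h0 heE hγ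
      have h2 := hI.trans hδ1
      gcongr
    exact ⟨heE, (inf t ht).trans (hpow α hα), (ing t ht).trans (hpow β hβ),
      (inh t ht).trans (hpow α hα)⟩
  have hI := intervalIntegral_le_of_bootstrap (w := fun s => Q (e s + f s + g s + h s))
    hδ.le hK hτ (hQcont.comp (((ce.add cf).add cg).add ch) hS)
    (fun t ht => hQnonneg _ (hS t ht)) (fun t ht hIt => by
      obtain ⟨h1, h2, h3, h4⟩ := key t ht hIt
      exact hQmono (hS t ht) hM0 (by linarith))
  intro t ht
  obtain ⟨h1, h2, h3, h4⟩ := key t ⟨ht.1, ht.2.trans (min_le_left _ _)⟩ (hI t ht)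
  exact ⟨by linarith, by linarith, by linarith, by linarith⟩
end
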